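/- arXiv:2412.05470 — 2 statements merged into one kernel-verified Lean document; each statement's English description precedes it below -/
import Mathlib

section
/- Let p be an odd prime, let n ≥ 2 be an integer, and let s > 0 be real. Let μ be the Haar measure on ℚ_p² normalized so that μ(ℤ_p²) = 1. Then ∫_{ℤ_p²} |y² − x^{2n}|_p^s dμ(x,y) = (p−1) · [ (p−1) p^{2ns+n−1}(p^{s+1} + 1) + (p^{s+1} − 1) · Σ_{j=1}^{n−1} p^{2js+j−1} ] / [ (p^{2ns+n+1} − 1)(p^{s+1} − 1) ]. -/
open MeasureTheory

theorem pow_mul_sum_range_inv_pow {W : ℝ} (hW : W ≠ 0) (n : ℕ) :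
    W ^ n * ∑ i ∈ Finset.range n, W⁻¹ ^ i = ∑ j ∈ Finset.Icc 1 n, W ^ j := by
  induction n with
  | zero => simp
  | succ n ih =>
    rw [Finset.sum_range_succ', Finset.sum_Icc_succ_top (by omega), ← ih]
    simp only [pow_succ, ← Finset.sum_mul]
    field_simp

section
variable {p : ℕ} [Fact p.Prime]

theorem Padic.norm_natCast_sub_lt_one_iff {i j : ℕ} (hi : i < p) (hj : j < p) :
    ‖(i : ℚ_[p]) - j‖ < 1 ↔ i = j := by
  constructor
  · intro h
    have h' : ‖(((i : ℤ) - j : ℤ) : ℚ_[p])‖ < 1 := by exact_mod_cast h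
    rw [Padic.norm_intCast_lt_one_iff] at h'
    obtain ⟨k, hk⟩ := h'
    have hk0 : k = 0 := by
      by_contra hk0
      rcases lt_or_gt_of_ne hk0 with h | h <;> nlinarith
    subst hk0
    omega
  · rintro rfl
    simp

theorem Padic.closedUnitBall_eq_biUnion :
    {x : ℚ_[p] | ‖x‖ ≤ 1} =
      ⋃ i ∈ Finset.range p, (fun x : ℚ_[p] => -(i : ℚ_[p]) + x) ⁻¹' {x | ‖x‖ < 1} := by
  ext x
  simp only [Set.mem_ofPred_eq, Set.mem_iUnion, Set.mem_preimage, Finset.mem_range, exists_prop]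
  constructor
  · intro hx
    obtain ⟨z, rfl⟩ : ∃ z : ℤ_[p], (z : ℚ_[p]) = x := ⟨⟨x, hx⟩, rfl⟩
    obtain ⟨i, hi, hm⟩ := PadicInt.exists_mem_range z
    refine ⟨i, hi, ?_⟩
    rw [PadicInt.maximalIdeal_eq_span_p, Ideal.mem_span_singleton,
      ← PadicInt.norm_lt_one_iff_dvd, PadicInt.norm_def] at hm
    rw [neg_add_eq_sub]
    rwa [PadicInt.coe_sub, PadicInt.coe_natCast] at hm
  · rintro ⟨i, -, hi⟩
    have h : x = i + (-i + x) := by ring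
    rw [h]
    exact (Padic.nonarchimedean _ _).trans
      (max_le (by simpa using Padic.norm_int_le_one (p := p) (i : ℤ)) hi.le)

theorem Padic.isCompact_closedUnitBall : IsCompact {x : ℚ_[p] | ‖x‖ ≤ 1} := by
  convert isCompact_closedBall (0 : ℚ_[p]) 1 using 1
  ext; simp

theorem Padic.norm_p_mul_rpow (x : ℚ_[p]) (s : ℝ) :
    ‖(p : ℚ_[p]) * x‖ ^ s = (p : ℝ)⁻¹ ^ s * ‖x‖ ^ s := by
  rw [norm_mul, Padic.norm_p, Real.mul_rpow (by positivity) (norm_nonneg _)]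

theorem Padic.norm_add_eq_one_of_norm_sub_lt_one (hp : Odd p) {a y : ℚ_[p]} (ha : ‖a‖ = 1)
    (h : ‖y - a‖ < 1) : ‖y + a‖ = 1 := by
  have h2 : ‖(2 : ℚ_[p])‖ = 1 := by
    have := (Padic.norm_natCast_eq_one_iff (p := p) (n := 2)).2
      ((Nat.coprime_two_right).2 hp)
    exact_mod_cast this
  have h3 : ‖2 * a‖ = 1 := by rw [norm_mul, h2, ha, one_mul]
  have h4 : y + a = (y - a) + 2 * a := by ring
  rw [h4, Padic.add_eq_max_of_ne (by rw [h3]; exact h.ne), h3, max_eq_right h.le]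

theorem Padic.norm_add_le_one {x y : ℚ_[p]} (hx : ‖x‖ ≤ 1) (hy : ‖y‖ ≤ 1) : ‖x + y‖ ≤ 1 :=
  (Padic.nonarchimedean _ _).trans (max_le hx hy)

theorem Padic.norm_sub_le_one {x y : ℚ_[p]} (hx : ‖x‖ ≤ 1) (hy : ‖y‖ ≤ 1) : ‖x - y‖ ≤ 1 := by
  rw [sub_eq_add_neg]
  exact Padic.norm_add_le_one hx (by rwa [norm_neg])

theorem Padic.norm_sq_sub_sq_rpow (hp : Odd p) {a y : ℚ_[p]} (ha : ‖a‖ = 1) (hy : ‖y‖ ≤ 1)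
    (s : ℝ) :
    ‖y ^ 2 - a ^ 2‖ ^ s =
      1 + ({x : ℚ_[p] | ‖x‖ < 1}.indicator (fun x => ‖x‖ ^ s - 1) (y - a) +
        {x : ℚ_[p] | ‖x‖ < 1}.indicator (fun x => ‖x‖ ^ s - 1) (y + a)) := by
  rw [sq_sub_sq, norm_mul]
  simp only [Set.indicator_apply, Set.mem_ofPred_eq]
  by_cases h1 : ‖y - a‖ < 1
  · simp [h1, Padic.norm_add_eq_one_of_norm_sub_lt_one hp ha h1]
  · have h1' : ‖y - a‖ = 1 := le_antisymm (Padic.norm_sub_le_one hy ha.le) (not_lt.1 h1)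
    by_cases h2 : ‖y + a‖ < 1
    · simp [h1', h2]
    · have h2' : ‖y + a‖ = 1 := le_antisymm (Padic.norm_add_le_one hy ha.le) (not_lt.1 h2)
      simp [h1', h2']

theorem Padic.continuous_norm_sq_sub_sq_rpow (a : ℚ_[p]) {s : ℝ} (hs : 0 ≤ s) :
    Continuous fun y : ℚ_[p] => ‖y ^ 2 - a ^ 2‖ ^ s :=
  Continuous.rpow_const (by fun_prop) fun _ => Or.inr hs

variable [MeasurableSpace ℚ_[p]] [BorelSpace ℚ_[p]]

theorem Padic.measurableSet_openUnitBall : MeasurableSet {x : ℚ_[p] | ‖x‖ < 1} :=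
  measurableSet_lt measurable_norm measurable_const

theorem Padic.measurableSet_closedUnitBall : MeasurableSet {x : ℚ_[p] | ‖x‖ ≤ 1} :=
  measurableSet_le measurable_norm measurable_const

theorem Padic.measurableSet_unitSphere : MeasurableSet {x : ℚ_[p] | ‖x‖ = 1} :=
  measurableSet_eq_fun measurable_norm measurable_const

theorem Padic.measure_openUnitBall (ν : Measure ℚ_[p]) [ν.IsAddHaarMeasure] :
    (p : ENNReal) * ν {x | ‖x‖ < 1} = ν {x | ‖x‖ ≤ 1} := by
  rw [Padic.closedUnitBall_eq_biUnion, measure_biUnion_finset]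
  · simp only [measure_preimage_add, Finset.sum_const, Finset.card_range, nsmul_eq_mul]
  · intro i hi j hj hij
    simp only [Finset.coe_range, Set.mem_Iio] at hi hj
    refine Set.disjoint_left.2 fun x hxi hxj => hij ?_
    rw [← Padic.norm_natCast_sub_lt_one_iff hi hj]
    simp only [Set.mem_preimage, Set.mem_ofPred_eq] at hxi hxj
    have h : (i : ℚ_[p]) - j = (-j + x) + -(-i + x) := by ring
    rw [h]
    exact (Padic.nonarchimedean _ _).trans_lt (max_lt hxj (by rwa [norm_neg]))
  · intro i _
    exact Padic.measurableSet_openUnitBall.preimage (measurable_const_add _)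

theorem Padic.setIntegral_openUnitBall (ν : Measure ℚ_[p]) [ν.IsAddHaarMeasure]
    (f : ℚ_[p] → ℝ) :
    ∫ x in {x | ‖x‖ < 1}, f x ∂ν = (p : ℝ)⁻¹ * ∫ x in {x | ‖x‖ ≤ 1}, f (p * x) ∂ν := by
  have hp0 : (p : ℚ_[p]) ≠ 0 := by exact_mod_cast (Fact.out : p.Prime).ne_zero
  have hpR : (0 : ℝ) < p := by exact_mod_cast (Fact.out : p.Prime).pos
  let e : ℚ_[p] ≃L[ℚ_[p]] ℚ_[p] :=
    ContinuousLinearEquiv.unitsEquivAut ℚ_[p] (Units.mk0 _ hp0)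
  have he : ∀ x, e x = p * x := fun x => by simp [e, mul_comm]
  have : (ν.map e).IsAddHaarMeasure := e.isAddHaarMeasure_map ν
  have hpre : e ⁻¹' {x | ‖x‖ < 1} = {x | ‖x‖ ≤ 1} := by
    ext x
    simp only [Set.mem_preimage, he, Set.mem_ofPred_eq, norm_mul, Padic.norm_p]
    rw [inv_mul_lt_iff₀ hpR, mul_one]
    have := Padic.norm_le_pow_iff_norm_lt_pow_add_one x 0
    simpa using this.symm
  set c := (ν.map e).addHaarScalarFactor ν
  have hc : ν.map e = c • ν := Measure.isAddLeftInvariant_eq_smul _ _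
  have hcp : (c : ENNReal) = p := by
    have h1 : ν.map e {x | ‖x‖ < 1} = ν {x | ‖x‖ ≤ 1} := by
      rw [Measure.map_apply e.continuous.measurable Padic.measurableSet_openUnitBall, hpre]
    rw [← Padic.measure_openUnitBall, hc, Measure.smul_apply, ENNReal.smul_def, smul_eq_mul] at h1
    have hO : IsOpen {x : ℚ_[p] | ‖x‖ < 1} := isOpen_lt continuous_norm continuous_const
    exact (ENNReal.mul_left_inj (hO.measure_pos ν ⟨0, by simp⟩).ne'
      (measure_ne_top_of_subset (fun x (hx : ‖x‖ < 1) => hx.le)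
        Padic.isCompact_closedUnitBall.measure_ne_top)).1 h1
  have hcp' : (c : ℝ) = p := by
    have := congrArg ENNReal.toReal hcp
    simpa using this
  have h2 := e.toHomeomorph.measurableEmbedding.setIntegral_map (μ := ν) f {x | ‖x‖ < 1}
  simp only [ContinuousLinearEquiv.coe_toHomeomorph] at h2
  rw [hpre, hc] at h2
  simp only [he] at h2
  rw [← h2, Measure.restrict_smul, integral_smul_nnreal_measure, NNReal.smul_def, hcp',
    smul_eq_mul, inv_mul_cancel_left₀ hpR.ne']

theorem Padic.setIntegral_closedUnitBall (ν : Measure ℚ_[p]) [ν.IsAddHaarMeasure]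
    {f : ℚ_[p] → ℝ} (hf : IntegrableOn f {x | ‖x‖ ≤ 1} ν) :
    ∫ x in {x | ‖x‖ ≤ 1}, f x ∂ν =
      ∫ x in {x | ‖x‖ = 1}, f x ∂ν + (p : ℝ)⁻¹ * ∫ x in {x | ‖x‖ ≤ 1}, f (p * x) ∂ν := by
  rw [← Padic.setIntegral_openUnitBall]
  have h : {x : ℚ_[p] | ‖x‖ ≤ 1} = {x | ‖x‖ = 1} ∪ {x | ‖x‖ < 1} := by
    ext x; simp [le_iff_eq_or_lt]
  rw [h] at hf ⊢
  refine setIntegral_union ?_ Padic.measurableSet_openUnitBall hf.left_of_union hf.right_of_union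
  exact Set.disjoint_left.2 fun x h1 h2 => (h2 : ‖x‖ < 1).ne h1

theorem Padic.measureReal_openUnitBall {ν : Measure ℚ_[p]} [ν.IsAddHaarMeasure]
    (hν : ν {x | ‖x‖ ≤ 1} = 1) : ν.real {x | ‖x‖ < 1} = (p : ℝ)⁻¹ := by
  have := Padic.setIntegral_openUnitBall ν (fun _ => 1)
  simpa [Measure.real, hν] using this

theorem Padic.measureReal_unitSphere {ν : Measure ℚ_[p]} [ν.IsAddHaarMeasure]
    (hν : ν {x | ‖x‖ ≤ 1} = 1) : ν.real {x | ‖x‖ = 1} = 1 - (p : ℝ)⁻¹ := by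
  have h := Padic.setIntegral_closedUnitBall ν (f := fun _ => 1) (by simp [hν])
  simp [Measure.real, hν] at h
  simp only [Measure.real]
  linarith

theorem Padic.integrableOn_closedUnitBall (ν : Measure ℚ_[p]) [ν.IsAddHaarMeasure]
    {f : ℚ_[p] → ℝ} (hf : Continuous f) : IntegrableOn f {x | ‖x‖ ≤ 1} ν :=
  hf.continuousOn.integrableOn_compact Padic.isCompact_closedUnitBall

theorem Padic.setIntegral_norm_rpow {ν : Measure ℚ_[p]} [ν.IsAddHaarMeasure]
    (hν : ν {x | ‖x‖ ≤ 1} = 1) {s : ℝ} (hs : 0 ≤ s) :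
    ∫ x in {x | ‖x‖ ≤ 1}, ‖x‖ ^ s ∂ν =
      (1 - (p : ℝ)⁻¹) + (p : ℝ)⁻¹ * ((p : ℝ)⁻¹ ^ s * ∫ x in {x | ‖x‖ ≤ 1}, ‖x‖ ^ s ∂ν) := by
  have hc : Continuous fun x : ℚ_[p] => ‖x‖ ^ s :=
    continuous_norm.rpow_const fun _ => Or.inr hs
  conv_lhs => rw [Padic.setIntegral_closedUnitBall ν (Padic.integrableOn_closedUnitBall ν hc)]
  simp only [Padic.norm_p_mul_rpow, integral_const_mul]
  rw [setIntegral_congr_fun (g := fun _ => (1 : ℝ)) Padic.measurableSet_unitSphere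
    fun x hx => by simp [show ‖x‖ = 1 from hx]]
  simp [Padic.measureReal_unitSphere hν]

theorem Padic.setIntegral_openUnitBall_norm_rpow_sub_one {ν : Measure ℚ_[p]}
    [ν.IsAddHaarMeasure] (hν : ν {x | ‖x‖ ≤ 1} = 1) {s : ℝ} (hs : 0 ≤ s) :
    ∫ x in {x | ‖x‖ < 1}, (‖x‖ ^ s - 1) ∂ν =
      (p : ℝ)⁻¹ * ((p : ℝ)⁻¹ ^ s * ∫ x in {x | ‖x‖ ≤ 1}, ‖x‖ ^ s ∂ν - 1) := by
  have hc : Continuous fun x : ℚ_[p] => ‖x‖ ^ s :=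
    continuous_norm.rpow_const fun _ => Or.inr hs
  rw [Padic.setIntegral_openUnitBall]
  simp only [Padic.norm_p_mul_rpow]
  rw [integral_sub ((Padic.integrableOn_closedUnitBall ν hc).const_mul _)
    (Padic.integrableOn_closedUnitBall ν continuous_const), integral_const_mul]
  simp [Measure.real, hν]

theorem Padic.setIntegral_indicator_add (ν : Measure ℚ_[p]) [ν.IsAddHaarMeasure]
    (f : ℚ_[p] → ℝ) {a : ℚ_[p]} (ha : ‖a‖ ≤ 1) :
    ∫ y in {y | ‖y‖ ≤ 1}, {x : ℚ_[p] | ‖x‖ < 1}.indicator f (y + a) ∂ν =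
      ∫ x in {x | ‖x‖ < 1}, f x ∂ν := by
  rw [setIntegral_eq_integral_of_forall_compl_eq_zero,
    integral_add_right_eq_self (fun y => {x : ℚ_[p] | ‖x‖ < 1}.indicator f y),
    integral_indicator Padic.measurableSet_openUnitBall]
  intro y hy
  refine Set.indicator_of_notMem (fun h => hy ?_) _
  have h4 : y = (y + a) - a := by ring
  rw [Set.mem_ofPred_eq, h4]
  exact Padic.norm_sub_le_one (le_of_lt h) ha

theorem Padic.setIntegral_norm_sq_sub_sq_of_norm_eq_one (hp : Odd p) {ν : Measure ℚ_[p]}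
    [ν.IsAddHaarMeasure] (hν : ν {x | ‖x‖ ≤ 1} = 1) {s : ℝ} (hs : 0 ≤ s) {a : ℚ_[p]}
    (ha : ‖a‖ = 1) :
    ∫ y in {y | ‖y‖ ≤ 1}, ‖y ^ 2 - a ^ 2‖ ^ s ∂ν =
      1 + 2 * ((p : ℝ)⁻¹ * ((p : ℝ)⁻¹ ^ s * ∫ x in {x | ‖x‖ ≤ 1}, ‖x‖ ^ s ∂ν - 1)) := by
  rw [setIntegral_congr_fun Padic.measurableSet_closedUnitBall
    fun y hy => Padic.norm_sq_sub_sq_rpow hp ha hy s]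
  have hc : Continuous fun x : ℚ_[p] => ‖x‖ ^ s - 1 :=
    (continuous_norm.rpow_const fun _ => Or.inr hs).sub continuous_const
  have hi : Integrable ({x : ℚ_[p] | ‖x‖ < 1}.indicator (fun x => ‖x‖ ^ s - 1)) ν :=
    (integrable_indicator_iff Padic.measurableSet_openUnitBall).2
      ((Padic.integrableOn_closedUnitBall ν hc).mono_set fun x (hx : ‖x‖ < 1) => hx.le)
  have h1 : IntegrableOn
      (fun y => {x : ℚ_[p] | ‖x‖ < 1}.indicator (fun x => ‖x‖ ^ s - 1) (y - a))
      {y | ‖y‖ ≤ 1} ν := (hi.comp_sub_right a).integrableOn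
  have h2 : IntegrableOn
      (fun y => {x : ℚ_[p] | ‖x‖ < 1}.indicator (fun x => ‖x‖ ^ s - 1) (y + a))
      {y | ‖y‖ ≤ 1} ν := (hi.comp_add_right a).integrableOn
  have h3 := Padic.setIntegral_indicator_add ν (fun x => ‖x‖ ^ s - 1) (a := -a)
    (by rw [norm_neg]; exact ha.le)
  simp only [← sub_eq_add_neg] at h3
  rw [integral_add (Padic.integrableOn_closedUnitBall ν continuous_const)
    (show IntegrableOn (fun y => _ + _) _ ν from h1.add h2), integral_add h1 h2, h3,
    Padic.setIntegral_indicator_add ν _ ha.le,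
    Padic.setIntegral_openUnitBall_norm_rpow_sub_one hν hs]
  simp [Measure.real, hν]
  ring

theorem Padic.setIntegral_norm_sq_sub_p_mul_sq {ν : Measure ℚ_[p]}
    [ν.IsAddHaarMeasure] (hν : ν {x | ‖x‖ ≤ 1} = 1) {s : ℝ} (hs : 0 ≤ s) {a : ℚ_[p]}
    (ha : ‖a‖ ≤ 1) :
    ∫ y in {y | ‖y‖ ≤ 1}, ‖y ^ 2 - (p * a) ^ 2‖ ^ s ∂ν =
      (1 - (p : ℝ)⁻¹) + (p : ℝ)⁻¹ * ((p : ℝ)⁻¹ ^ s) ^ 2 *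
        ∫ y in {y | ‖y‖ ≤ 1}, ‖y ^ 2 - a ^ 2‖ ^ s ∂ν := by
  rw [Padic.setIntegral_closedUnitBall ν (Padic.integrableOn_closedUnitBall ν
    (Padic.continuous_norm_sq_sub_sq_rpow _ hs))]
  have h (y : ℚ_[p]) : ‖(p * y) ^ 2 - (p * a) ^ 2‖ ^ s =
      ((p : ℝ)⁻¹ ^ s) ^ 2 * ‖y ^ 2 - a ^ 2‖ ^ s := by
    have : (p * y) ^ 2 - (p * a) ^ 2 = (p : ℚ_[p]) * (p * (y ^ 2 - a ^ 2)) := by ring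
    rw [this, Padic.norm_p_mul_rpow, Padic.norm_p_mul_rpow]
    ring
  simp only [h, integral_const_mul]
  rw [setIntegral_congr_fun (g := fun _ => (1 : ℝ)) Padic.measurableSet_unitSphere]
  · simp [Padic.measureReal_unitSphere hν, mul_assoc]
  · intro y hy
    have hy1 : ‖y ^ 2‖ = 1 := by rw [norm_pow, show ‖y‖ = 1 from hy, one_pow]
    have ha1 : ‖-((p : ℚ_[p]) * a) ^ 2‖ < 1 := by
      rw [norm_neg, norm_pow, norm_mul]
      have := Padic.norm_p_lt_one (p := p)
      exact pow_lt_one₀ (by positivity) (mul_lt_one_of_nonneg_of_lt_one_left (norm_nonneg _) this ha)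
        two_ne_zero
    have : ‖y ^ 2 - (p * a) ^ 2‖ = 1 := by
      rw [sub_eq_add_neg, Padic.add_eq_max_of_ne (by rw [hy1]; exact ha1.ne'), hy1,
        max_eq_left ha1.le]
    simp [this]

theorem Padic.setIntegral_norm_sq_sub_p_pow_mul_sq {ν : Measure ℚ_[p]}
    [ν.IsAddHaarMeasure] (hν : ν {x | ‖x‖ ≤ 1} = 1) {s : ℝ} (hs : 0 ≤ s) {a : ℚ_[p]}
    (ha : ‖a‖ ≤ 1) (k : ℕ) :
    ∫ y in {y | ‖y‖ ≤ 1}, ‖y ^ 2 - (p ^ k * a) ^ 2‖ ^ s ∂ν =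
      (1 - (p : ℝ)⁻¹) * ∑ i ∈ Finset.range k, ((p : ℝ)⁻¹ * ((p : ℝ)⁻¹ ^ s) ^ 2) ^ i +
        ((p : ℝ)⁻¹ * ((p : ℝ)⁻¹ ^ s) ^ 2) ^ k *
          ∫ y in {y | ‖y‖ ≤ 1}, ‖y ^ 2 - a ^ 2‖ ^ s ∂ν := by
  induction k with
  | zero => simp
  | succ k ih =>
    have h : ‖(p : ℚ_[p]) ^ k * a‖ ≤ 1 := by
      rw [norm_mul, norm_pow]
      exact mul_le_one₀ (pow_le_one₀ (norm_nonneg _) Padic.norm_p_lt_one.le) (norm_nonneg _) ha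
    rw [pow_succ' (p : ℚ_[p]) k, mul_assoc (p : ℚ_[p]),
      Padic.setIntegral_norm_sq_sub_p_mul_sq hν hs h, ih,
      Finset.sum_range_succ', ← Finset.sum_congr rfl fun i _ => (pow_succ' _ i).symm,
      ← Finset.mul_sum]
    ring

theorem Padic.igusa_functional_equation (hp : Odd p) {ν : Measure ℚ_[p]}
    [ν.IsAddHaarMeasure] (hν : ν {x | ‖x‖ ≤ 1} = 1) {s : ℝ} (hs : 0 ≤ s) (n : ℕ)
    {f : ℚ_[p] → ℝ} (hf : ∀ x, f x = ∫ y in {y | ‖y‖ ≤ 1}, ‖y ^ 2 - (x ^ n) ^ 2‖ ^ s ∂ν)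
    (hi : IntegrableOn f {x | ‖x‖ ≤ 1} ν) :
    ∫ x in {x | ‖x‖ ≤ 1}, f x ∂ν =
      (1 - (p : ℝ)⁻¹) *
        (1 + 2 * ((p : ℝ)⁻¹ * ((p : ℝ)⁻¹ ^ s * ∫ x in {x | ‖x‖ ≤ 1}, ‖x‖ ^ s ∂ν - 1))) +
      (p : ℝ)⁻¹ *
        ((1 - (p : ℝ)⁻¹) * ∑ i ∈ Finset.range n, ((p : ℝ)⁻¹ * ((p : ℝ)⁻¹ ^ s) ^ 2) ^ i +
          ((p : ℝ)⁻¹ * ((p : ℝ)⁻¹ ^ s) ^ 2) ^ n * ∫ x in {x | ‖x‖ ≤ 1}, f x ∂ν) := by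
  conv_lhs => rw [Padic.setIntegral_closedUnitBall ν hi]
  congr 1
  · rw [setIntegral_congr_fun Padic.measurableSet_unitSphere fun x hx => by
      rw [hf, Padic.setIntegral_norm_sq_sub_sq_of_norm_eq_one hp hν hs
        (by rw [norm_pow, show ‖x‖ = 1 from hx, one_pow])]]
    simp [Padic.measureReal_unitSphere hν]
  · congr 1
    rw [setIntegral_congr_fun Padic.measurableSet_closedUnitBall fun x hx => by
      rw [hf, mul_pow, Padic.setIntegral_norm_sq_sub_p_pow_mul_sq hν hs
        (by rw [norm_pow]; exact pow_le_one₀ (norm_nonneg _) hx), ← hf]]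
    rw [integral_add (Padic.integrableOn_closedUnitBall ν continuous_const) (hi.const_mul _),
      integral_const_mul _ f]
    simp [Measure.real, hν]

theorem Padic.exists_prod_isAddHaarMeasure (μ : Measure (ℚ_[p] × ℚ_[p])) [μ.IsAddHaarMeasure]
    (hμ : μ ({x : ℚ_[p] | ‖x‖ ≤ 1} ×ˢ {y : ℚ_[p] | ‖y‖ ≤ 1}) = 1) :
    ∃ ν : Measure ℚ_[p], ν.IsAddHaarMeasure ∧ ν {x | ‖x‖ ≤ 1} = 1 ∧ μ = ν.prod ν := by
  let K : TopologicalSpace.PositiveCompacts ℚ_[p] :=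
    { carrier := {x | ‖x‖ ≤ 1}
      isCompact' := Padic.isCompact_closedUnitBall
      interior_nonempty' := by
        refine ⟨0, mem_interior.2 ⟨{x | ‖x‖ < 1}, fun x (hx : ‖x‖ < 1) => hx.le,
          isOpen_lt continuous_norm continuous_const, by simp⟩⟩ }
  have hK : Measure.addHaarMeasure K {x | ‖x‖ ≤ 1} = 1 := Measure.addHaarMeasure_self
  refine ⟨Measure.addHaarMeasure K, inferInstance, hK, ?_⟩
  set ν := Measure.addHaarMeasure K
  have h := Measure.isAddLeftInvariant_eq_smul μ (ν.prod ν)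
  have h1 := congrArg (fun m => m ({x : ℚ_[p] | ‖x‖ ≤ 1} ×ˢ {y : ℚ_[p] | ‖y‖ ≤ 1})) h
  simp only [hμ, Measure.smul_apply, Measure.prod_prod, hK, ENNReal.smul_def, smul_eq_mul,
    mul_one] at h1
  have h2 : μ.addHaarScalarFactor (ν.prod ν) = 1 := by exact_mod_cast h1.symm
  rw [h, h2, one_smul]

end

/-- The Igusa local zeta function of the `A_{2n−1}`-singularity `f(x,y) = y² − x^{2n}`. -/
theorem stmt_12 (p : ℕ) [Fact p.Prime] (hp : Odd p)
    [MeasurableSpace ℚ_[p]] [BorelSpace ℚ_[p]]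
    (μ : Measure (ℚ_[p] × ℚ_[p])) [μ.IsAddHaarMeasure]
    (hμ : μ ({x : ℚ_[p] | ‖x‖ ≤ 1} ×ˢ {y : ℚ_[p] | ‖y‖ ≤ 1}) = 1)
    (n : ℕ) (hn : 2 ≤ n) (s : ℝ) (hs : 0 < s) :
    (∫ z in ({x : ℚ_[p] | ‖x‖ ≤ 1} ×ˢ {y : ℚ_[p] | ‖y‖ ≤ 1}),
        ‖z.2 ^ 2 - z.1 ^ (2 * n)‖ ^ s ∂μ)
      = ((p : ℝ) - 1) *
          (((p : ℝ) - 1) * (p : ℝ) ^ (2 * (n : ℝ) * s + (n : ℝ) - 1) *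
              ((p : ℝ) ^ (s + 1) + 1)
            + ((p : ℝ) ^ (s + 1) - 1) *
                (∑ j ∈ Finset.Icc 1 (n - 1), (p : ℝ) ^ (2 * (j : ℝ) * s + (j : ℝ) - 1))) /
          (((p : ℝ) ^ (2 * (n : ℝ) * s + (n : ℝ) + 1) - 1) * ((p : ℝ) ^ (s + 1) - 1)) := by
  obtain ⟨ν, hν', hν, rfl⟩ := Padic.exists_prod_isAddHaarMeasure μ hμ
  have hi : IntegrableOn (fun z : ℚ_[p] × ℚ_[p] => ‖z.2 ^ 2 - (z.1 ^ n) ^ 2‖ ^ s)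
      ({x : ℚ_[p] | ‖x‖ ≤ 1} ×ˢ {y : ℚ_[p] | ‖y‖ ≤ 1}) (ν.prod ν) := by
    have hc : Continuous fun z : ℚ_[p] × ℚ_[p] => ‖z.2 ^ 2 - (z.1 ^ n) ^ 2‖ ^ s :=
      Continuous.rpow_const (by fun_prop) fun _ => Or.inr hs.le
    exact hc.continuousOn.integrableOn_compact
      (Padic.isCompact_closedUnitBall.prod Padic.isCompact_closedUnitBall)
  have hi' : IntegrableOn
      (fun x : ℚ_[p] => ∫ y in {y | ‖y‖ ≤ 1}, ‖y ^ 2 - (x ^ n) ^ 2‖ ^ s ∂ν) {x | ‖x‖ ≤ 1} ν := by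
    rw [IntegrableOn, ← Measure.prod_restrict] at hi
    exact hi.integral_prod_left
  simp only [mul_comm 2 n, pow_mul]
  rw [setIntegral_prod _ hi]
  have hZ := Padic.igusa_functional_equation hp hν hs.le n (fun _ => rfl) hi'
  have hI := Padic.setIntegral_norm_rpow hν hs.le
  dsimp only at hZ ⊢
  generalize (∫ x in {x : ℚ_[p] | ‖x‖ ≤ 1}, ∫ y in {y : ℚ_[p] | ‖y‖ ≤ 1},
    ‖y ^ 2 - (x ^ n) ^ 2‖ ^ s ∂ν ∂ν) = Z at hZ ⊢
  generalize (∫ x in {x : ℚ_[p] | ‖x‖ ≤ 1}, ‖x‖ ^ s ∂ν) = I at hZ hI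
  have hP : (1 : ℝ) < p := by exact_mod_cast (Fact.out : p.Prime).one_lt
  have hP0 : (0 : ℝ) < p := by linarith
  have hR : (1 : ℝ) < (p : ℝ) ^ s := Real.one_lt_rpow hP hs
  have hpow (j : ℕ) : (p : ℝ) ^ (2 * (j : ℝ) * s + (j : ℝ)) = (p * ((p : ℝ) ^ s) ^ 2) ^ j := by
    rw [Real.rpow_add hP0, mul_pow, ← pow_mul, Real.rpow_natCast,
      ← Real.rpow_natCast ((p : ℝ) ^ s), ← Real.rpow_mul hP0.le]
    push_cast
    ring_nf
  simp only [Real.rpow_sub hP0, Real.rpow_add_one hP0.ne', Real.rpow_one, hpow,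
    ← Finset.sum_div]
  rw [Real.inv_rpow hP0.le, inv_pow ((p : ℝ) ^ s), ← mul_inv, inv_pow _ n] at hZ
  rw [Real.inv_rpow hP0.le] at hI
  generalize (p : ℝ) ^ s = R at *
  generalize (p : ℝ) = P at *
  have hR0 : 0 < R := by linarith
  have hW : P * R ^ 2 ≠ 0 := by positivity
  have hS := pow_mul_sum_range_inv_pow hW n
  obtain ⟨m, rfl⟩ : ∃ m, n = m + 1 := ⟨n - 1, by omega⟩
  rw [Finset.sum_Icc_succ_top (by omega)] at hS
  rw [Nat.add_sub_cancel]
  have hV : 1 ≤ (P * R ^ 2) ^ (m + 1) := one_le_pow₀ (by nlinarith)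
  generalize (P * R ^ 2) ^ (m + 1) = V at *
  generalize (∑ j ∈ Finset.Icc 1 m, (P * R ^ 2) ^ j) = S at *
  generalize (∑ i ∈ Finset.range (m + 1), (P * R ^ 2)⁻¹ ^ i) = A at *
  have hV0 : 0 < V := by linarith
  have hRP : R * P - 1 ≠ 0 := by nlinarith
  have hPR : P * R - 1 ≠ 0 := by nlinarith
  have hVP : V * P - 1 ≠ 0 := by nlinarith
  have hI' : I = (P - 1) * R / (R * P - 1) := by
    rw [eq_div_iff hRP]
    field_simp at hI
    linear_combination hI
  have hA : A = (S + V) / V := by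
    rw [eq_div_iff hV0.ne']
    linear_combination hS
  rw [hI', hA] at hZ
  rw [eq_div_iff (mul_ne_zero hVP hRP)]
  field_simp at hZ ⊢
  linear_combination hZ
end

section
/- Let p be a prime with p > 3 and let s > 0 be real. Let μ be the Haar measure on ℚ_p² normalized so that μ(ℤ_p²) = 1. Then ∫_{ℤ_p²} |y³ − x⁴|_p^s dμ(x,y) = (p−1) p^{3s} ( p^{10s+7} − p^{9s+5} + p^{7s+5} − p^{5s+3} + p^{4s+3} − p^{3s+2} + p^{2s+2} − 1 ) / [ (p^{12s+7} − 1)(p^{s+1} − 1) ]. -/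
open MeasureTheory

lemma rpow_inv_pow_natCast (p : ℕ) (s : ℝ) (n : ℕ) :
    ((p : ℝ)⁻¹ ^ n) ^ s = ((p : ℝ) ^ (-s)) ^ n := by
  have hp : (0 : ℝ) ≤ p := Nat.cast_nonneg p
  rw [Real.rpow_neg hp, ← Real.inv_rpow hp, ← Real.rpow_natCast, ← Real.rpow_natCast,
    ← Real.rpow_mul (inv_nonneg.2 hp), ← Real.rpow_mul (inv_nonneg.2 hp), mul_comm]

section
variable (p : ℕ) [Fact p.Prime]

/-- The closed ball `pⁿ ℤ_p` in `ℚ_p`. -/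
def padicBall (n : ℕ) : Set ℚ_[p] := {x | ‖x‖ ≤ (p : ℝ)⁻¹ ^ n}

/-- The sphere of radius `p⁻ⁿ` in `ℚ_p`. -/
def padicSphere (n : ℕ) : Set ℚ_[p] := {x | ‖x‖ = (p : ℝ)⁻¹ ^ n}

lemma padicBall_zero : padicBall p 0 = {x | ‖x‖ ≤ 1} := by simp [padicBall]

lemma padicBall_eq_closedBall (n : ℕ) :
    padicBall p n = Metric.closedBall 0 ((p : ℝ)⁻¹ ^ n) := by
  ext x; simp [padicBall]

lemma isCompact_padicBall (n : ℕ) : IsCompact (padicBall p n) := by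
  rw [padicBall_eq_closedBall]; exact isCompact_closedBall _ _

lemma mem_padicBall_iff_norm_lt (n : ℕ) (x : ℚ_[p]) :
    x ∈ padicBall p (n + 1) ↔ ‖x‖ < (p : ℝ)⁻¹ ^ n := by
  have := Padic.norm_le_pow_iff_norm_lt_pow_add_one x (-(n + 1 : ℕ) : ℤ)
  have e : (-((n + 1 : ℕ) : ℤ) + 1) = -(n : ℤ) := by push_cast; ring
  rw [e, zpow_neg, zpow_neg, zpow_natCast, zpow_natCast] at this
  simpa [padicBall] using this

lemma padicBall_eq_union (n : ℕ) :
    padicBall p n = padicSphere p n ∪ padicBall p (n + 1) := by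
  ext x
  rw [Set.mem_union, mem_padicBall_iff_norm_lt]
  simp only [padicBall, padicSphere, Set.mem_ofPred_eq]
  rw [le_iff_eq_or_lt]

lemma disjoint_padicSphere_padicBall (n : ℕ) :
    Disjoint (padicSphere p n) (padicBall p (n + 1)) := by
  rw [Set.disjoint_left]
  intro x hx
  rw [mem_padicBall_iff_norm_lt]
  simp only [padicSphere, Set.mem_ofPred_eq] at hx
  simp [hx]

lemma padicSphere_subset_padicBall (n : ℕ) : padicSphere p n ⊆ padicBall p n := by
  rw [padicBall_eq_union]; exact Set.subset_union_left

lemma continuous_norm_rpow_comp {X : Type*} [TopologicalSpace X] {s : ℝ} (hs : 0 < s)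
    {f : X → ℚ_[p]} (hf : Continuous f) : Continuous fun x => ‖f x‖ ^ s :=
  hf.norm.rpow_const fun _ => Or.inr hs.le

lemma rpow_neg_mul_inv_lt_one {s : ℝ} (hs : 0 < s) : (p : ℝ) ^ (-s) * (p : ℝ)⁻¹ < 1 := by
  have h1 : (1 : ℝ) < p := by exact_mod_cast (Fact.out : p.Prime).one_lt
  have h2 : (p : ℝ) ^ (-s) < 1 := Real.rpow_lt_one_of_one_lt_of_neg h1 (by linarith)
  have h3 : (p : ℝ)⁻¹ < 1 := inv_lt_one_of_one_lt₀ h1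
  have := mul_lt_mul'' h2 h3 (by positivity) (by positivity)
  simpa using this

lemma norm_inv_pow_lt {m n : ℕ} (h : m < n) : (p : ℝ)⁻¹ ^ n < (p : ℝ)⁻¹ ^ m := by
  have h1 : (1 : ℝ) < p := by exact_mod_cast (Fact.out : p.Prime).one_lt
  exact pow_lt_pow_right_of_lt_one₀ (by positivity) (inv_lt_one_of_one_lt₀ h1) h

variable [MeasurableSpace ℚ_[p]] [BorelSpace ℚ_[p]]

lemma measurableSet_padicBall (n : ℕ) : MeasurableSet (padicBall p n) :=
  (isCompact_padicBall p n).measurableSet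

lemma measurableSet_padicSphere (n : ℕ) : MeasurableSet (padicSphere p n) :=
  measurableSet_eq_fun measurable_norm measurable_const

variable (ν : Measure ℚ_[p]) [ν.IsAddHaarMeasure]

omit [BorelSpace ℚ_[p]] in
lemma measure_padicBall_ne_top (n : ℕ) : ν (padicBall p n) ≠ ⊤ :=
  (isCompact_padicBall p n).measure_lt_top.ne

/-- The unit ball of `ℚ_p` as a compact set with nonempty interior. -/
def padicUnitBall : TopologicalSpace.PositiveCompacts ℚ_[p] where
  carrier := padicBall p 0
  isCompact' := isCompact_padicBall p 0
  interior_nonempty' := ⟨0, by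
    rw [padicBall_eq_closedBall]
    exact Metric.ball_subset_interior_closedBall (by simp)⟩

variable {ν} (hν : ν (padicBall p 0) = 1)
include hν

lemma map_mul_left_padic {c : ℚ_[p]} (hc : c ≠ 0) :
    ν.map (c * ·) = ν ((c * ·) ⁻¹' padicBall p 0) • ν := by
  have hH : (ν.map (c * ·)).IsAddHaarMeasure :=
    AddEquiv.isAddHaarMeasure_map ν (AddAut.mulLeft (Units.mk0 c hc))
      (continuous_const_mul c) (continuous_const_mul c⁻¹)
  have h1 := Measure.addHaarMeasure_unique ν (padicUnitBall p)
  have h2 := Measure.addHaarMeasure_unique (ν.map (c * ·)) (padicUnitBall p)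
  have h3 : ν (padicUnitBall p) = 1 := hν
  rw [h3, one_smul] at h1
  rw [h2, ← h1, Measure.map_apply (measurable_const_mul c)
    (padicUnitBall p).isCompact.measurableSet]
  rfl

lemma measureReal_padicBall_one : ν.real (padicBall p 1) = (p : ℝ)⁻¹ := by
  have hU : padicBall p 0 = ⋃ i ∈ Finset.range p, (fun x => x + -(i : ℚ_[p])) ⁻¹' padicBall p 1 := by
    ext x
    simp only [Set.mem_iUnion, Finset.mem_range, Set.mem_preimage, exists_prop,
      mem_padicBall_iff_norm_lt p 0, pow_zero, padicBall_zero, Set.mem_ofPred_eq]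
    constructor
    · intro hx
      obtain ⟨z, rfl⟩ : ∃ z : ℤ_[p], (z : ℚ_[p]) = x := ⟨⟨x, hx⟩, rfl⟩
      refine ⟨_, PadicInt.zmodRepr_lt_p z, ?_⟩
      have h := PadicInt.norm_sub_zmodRepr_lt_one z
      rwa [PadicInt.norm_def, PadicInt.coe_sub, PadicInt.coe_natCast, sub_eq_add_neg] at h
    · rintro ⟨i, -, hi⟩
      have := Padic.nonarchimedean (x + -(i : ℚ_[p])) i
      rw [neg_add_cancel_right] at this
      exact this.trans (max_le hi.le (by simpa using Padic.norm_int_le_one (i : ℤ)))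
  have hd : Set.PairwiseDisjoint (Finset.range p : Set ℕ)
      (fun i : ℕ => (fun x => x + -(i : ℚ_[p])) ⁻¹' padicBall p 1) := by
    intro i hi j hj hij
    rw [Function.onFun, Set.disjoint_left]
    intro x hx hx'
    simp only [Set.mem_preimage, mem_padicBall_iff_norm_lt p 0, pow_zero] at hx hx'
    apply hij
    have h1 : ‖((i - j : ℤ) : ℚ_[p])‖ < 1 := by
      have := Padic.nonarchimedean (x + -(j : ℚ_[p])) (-(x + -(i : ℚ_[p])))
      rw [norm_neg] at this
      refine lt_of_eq_of_lt ?_ (this.trans_lt (max_lt hx' hx))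
      congr 1; push_cast; ring
    rw [Padic.norm_intCast_lt_one_iff] at h1
    have := Int.eq_zero_of_abs_lt_dvd h1 (by
      simp only [Finset.coe_range, Set.mem_Iio] at hi hj
      rw [abs_lt]; omega)
    omega
  have h := measure_biUnion_finset (μ := ν) hd
    (fun i _ => (measurableSet_padicBall p 1).preimage (measurable_add_const _))
  rw [← hU, hν] at h
  simp only [measure_preimage_add_right, Finset.sum_const, Finset.card_range, nsmul_eq_mul] at h
  have h' := congrArg ENNReal.toReal h
  rw [ENNReal.toReal_mul] at h'
  simp only [ENNReal.toReal_one, ENNReal.toReal_natCast] at h'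
  exact eq_inv_of_mul_eq_one_right h'.symm

lemma measureReal_padicBall (n : ℕ) : ν.real (padicBall p n) = (p : ℝ)⁻¹ ^ n := by
  have hp : (p : ℝ) ≠ 0 := by exact_mod_cast (Fact.out : p.Prime).ne_zero
  have hp' : (p : ℚ_[p]) ≠ 0 := by exact_mod_cast (Fact.out : p.Prime).ne_zero
  have hpos : (0 : ℝ) < p := by exact_mod_cast (Fact.out : p.Prime).pos
  have hpre (n : ℕ) : ((p : ℚ_[p])⁻¹ * ·) ⁻¹' padicBall p n = padicBall p (n + 1) := by
    ext x
    simp only [padicBall, Set.mem_preimage, Set.mem_ofPred_eq, norm_mul, norm_inv,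
      Padic.norm_p, inv_inv, pow_succ']
    rw [inv_mul_eq_div, le_div_iff₀' hpos]
  induction n with
  | zero => simp [Measure.real, hν]
  | succ n ih =>
    have h := map_mul_left_padic p hν (inv_ne_zero hp')
    have h2 := congrArg (fun m => m.real (padicBall p n)) h
    simp only [measureReal_ennreal_smul_apply] at h2
    rw [map_measureReal_apply (measurable_const_mul _) (measurableSet_padicBall p n),
      hpre, hpre, ih] at h2
    rw [h2, pow_succ', ← measureReal_padicBall_one p hν]; rfl

lemma measureReal_padicSphere (n : ℕ) :
    ν.real (padicSphere p n) = (1 - (p : ℝ)⁻¹) * (p : ℝ)⁻¹ ^ n := by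
  have h := measureReal_union (μ := ν) (disjoint_padicSphere_padicBall p n)
    (measurableSet_padicBall p _)
    (measure_ne_top_of_subset (padicSphere_subset_padicBall p n) (measure_padicBall_ne_top p ν n))
    (measure_padicBall_ne_top p ν _)
  rw [← padicBall_eq_union, measureReal_padicBall p hν, measureReal_padicBall p hν] at h
  rw [pow_succ] at h; linarith

lemma setIntegral_preimage_mul_left_padic {c : ℚ_[p]} (hc : c ≠ 0) (S : Set ℚ_[p])
    (g : ℚ_[p] → ℝ) :
    ∫ x in (c * ·) ⁻¹' S, g (c * x) ∂ν =
      ν.real ((c * ·) ⁻¹' padicBall p 0) * ∫ x in S, g x ∂ν := by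
  have h := (Homeomorph.mulLeft₀ c hc).measurableEmbedding.setIntegral_map (μ := ν) g S
  have h2 : Measure.map (Homeomorph.mulLeft₀ c hc) ν = _ := map_mul_left_padic p hν hc
  rw [h2, Measure.restrict_smul, integral_smul_measure] at h
  exact h.symm

lemma setIntegral_padicBall_scale (n : ℕ) (g : ℚ_[p] → ℝ) :
    ∫ x in padicBall p n, g x ∂ν =
      (p : ℝ)⁻¹ ^ n * ∫ x in padicBall p 0, g ((p : ℚ_[p]) ^ n * x) ∂ν := by
  have hp' : (p : ℚ_[p]) ≠ 0 := by exact_mod_cast (Fact.out : p.Prime).ne_zero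
  have hpos : (0 : ℝ) < p := by exact_mod_cast (Fact.out : p.Prime).pos
  have hpre : (((p : ℚ_[p]) ^ n)⁻¹ * ·) ⁻¹' padicBall p 0 = padicBall p n := by
    ext x
    simp only [padicBall, Set.mem_preimage, Set.mem_ofPred_eq, norm_mul, norm_inv, norm_pow,
      Padic.norm_p, inv_inv, pow_zero, inv_pow]
    rw [← one_div, le_div_iff₀' (by positivity)]
  have h := setIntegral_preimage_mul_left_padic p hν (inv_ne_zero (pow_ne_zero n hp'))
    (padicBall p 0) (fun x => g ((p : ℚ_[p]) ^ n * x))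
  rw [hpre, measureReal_padicBall p hν] at h
  rw [← h]
  simp [mul_inv_cancel_left₀ (pow_ne_zero n hp')]

lemma setIntegral_padicSphere_mul_unit {c : ℚ_[p]} (hc : ‖c‖ = 1) (g : ℚ_[p] → ℝ) :
    ∫ x in padicSphere p 0, g (c * x) ∂ν = ∫ x in padicSphere p 0, g x ∂ν := by
  have hc0 : c ≠ 0 := by rw [← norm_pos_iff, hc]; exact one_pos
  have h := setIntegral_preimage_mul_left_padic p hν hc0 (padicSphere p 0) g
  have h1 : (c * ·) ⁻¹' padicSphere p 0 = padicSphere p 0 := by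
    ext x; simp [padicSphere, hc]
  have h2 : (c * ·) ⁻¹' padicBall p 0 = padicBall p 0 := by
    ext x; simp [padicBall, hc]
  rw [h1, h2, measureReal_padicBall p hν] at h
  simpa using h

end

section
variable (p : ℕ) [Fact p.Prime] [MeasurableSpace ℚ_[p]] [BorelSpace ℚ_[p]]
  {ν : Measure ℚ_[p]} [ν.IsAddHaarMeasure]

/-- The one-variable Igusa integral `∫_{ℤ_p} |x|^s`. -/
lemma setIntegral_padicBall_norm_rpow (hν : ν (padicBall p 0) = 1) {s : ℝ} (hs : 0 < s) :
    ∫ x in padicBall p 0, ‖x‖ ^ s ∂ν =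
      (1 - (p : ℝ)⁻¹) / (1 - (p : ℝ) ^ (-s) * (p : ℝ)⁻¹) := by
  have hi (n : ℕ) : IntegrableOn (fun x : ℚ_[p] => ‖x‖ ^ s) (padicBall p n) ν :=
    (continuous_norm_rpow_comp p hs continuous_id).continuousOn.integrableOn_compact
      (isCompact_padicBall p n)
  have h1 : ∫ x in padicSphere p 0, ‖x‖ ^ s ∂ν = 1 - (p : ℝ)⁻¹ := by
    rw [setIntegral_congr_fun (g := fun _ => (1 : ℝ)) (measurableSet_padicSphere p 0)
      (fun x hx => by
        have : ‖x‖ = 1 := by simpa [padicSphere] using hx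
        simp [this]), setIntegral_const, measureReal_padicSphere p hν]
    simp
  have h2 := setIntegral_padicBall_scale p hν 1 (fun x => ‖x‖ ^ s)
  simp only [norm_mul, pow_one, Padic.norm_p] at h2
  simp_rw [Real.mul_rpow (inv_nonneg.2 (Nat.cast_nonneg p)) (norm_nonneg _)] at h2
  rw [integral_const_mul] at h2
  have h3 : ((p : ℝ)⁻¹) ^ s = (p : ℝ) ^ (-s) := by simpa using rpow_inv_pow_natCast p s 1
  rw [h3] at h2
  have h4 := setIntegral_union (f := fun x : ℚ_[p] => ‖x‖ ^ s)
    (disjoint_padicSphere_padicBall p 0) (measurableSet_padicBall p _)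
    ((hi 0).mono_set (padicSphere_subset_padicBall p 0)) (hi 1)
  rw [← padicBall_eq_union, h1, h2] at h4
  have h5 := rpow_neg_mul_inv_lt_one p hs
  rw [eq_div_iff (by linarith)]
  linear_combination h4

/-- Integrating `|x - c|^s` over the units, for a unit `c`. -/
lemma setIntegral_padicSphere_norm_sub_rpow (hν : ν (padicBall p 0) = 1) {s : ℝ} (hs : 0 < s)
    {c : ℚ_[p]} (hc : ‖c‖ = 1) :
    ∫ x in padicSphere p 0, ‖c - x‖ ^ s ∂ν =
      (∫ x in padicBall p 0, ‖x‖ ^ s ∂ν) - (p : ℝ)⁻¹ := by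
  have hi (n : ℕ) : IntegrableOn (fun x : ℚ_[p] => ‖c - x‖ ^ s) (padicBall p n) ν :=
    (continuous_norm_rpow_comp p hs (by fun_prop)).continuousOn.integrableOn_compact
      (isCompact_padicBall p n)
  have h1 : ∫ x in padicBall p 1, ‖c - x‖ ^ s ∂ν = (p : ℝ)⁻¹ := by
    rw [setIntegral_congr_fun (g := fun _ => (1 : ℝ)) (measurableSet_padicBall p 1)
      (fun x hx => by
        have hx : ‖x‖ < 1 := by simpa using (mem_padicBall_iff_norm_lt p 0 x).1 hx
        have : ‖c - x‖ = 1 := by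
          rw [sub_eq_add_neg, Padic.add_eq_max_of_ne (by rw [norm_neg, hc]; exact hx.ne'),
            norm_neg, hc, max_eq_left hx.le]
        simp [this]), setIntegral_const, measureReal_padicBall p hν]
    simp
  have h2 : ∫ x in padicBall p 0, ‖c - x‖ ^ s ∂ν = ∫ x in padicBall p 0, ‖x‖ ^ s ∂ν := by
    have h := (Homeomorph.addRight (-c)).measurableEmbedding.setIntegral_map (μ := ν)
      (fun x => ‖x‖ ^ s) (padicBall p 0)
    have hm : Measure.map (Homeomorph.addRight (-c)) ν = ν := map_add_right_eq_self ν (-c)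
    have hpre : (Homeomorph.addRight (-c)) ⁻¹' padicBall p 0 = padicBall p 0 := by
      ext x
      simp only [padicBall_zero, Set.mem_preimage, Set.mem_ofPred_eq, Homeomorph.coe_addRight]
      constructor
      · intro h
        have := Padic.nonarchimedean (x + -c) c
        rw [neg_add_cancel_right] at this
        exact this.trans (max_le h hc.le)
      · intro h
        exact (Padic.nonarchimedean x (-c)).trans (max_le h (by rw [norm_neg, hc]))
    rw [hm, hpre] at h
    rw [h]
    simp only [Homeomorph.coe_addRight, ← sub_eq_add_neg, norm_sub_rev]
  have h4 := setIntegral_union (f := fun x : ℚ_[p] => ‖c - x‖ ^ s)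
    (disjoint_padicSphere_padicBall p 0) (measurableSet_padicBall p _)
    ((hi 0).mono_set (padicSphere_subset_padicBall p 0)) (hi 1)
  rw [← padicBall_eq_union, h1, h2] at h4
  linarith

lemma integrableOn_cusp (ν' : Measure (ℚ_[p] × ℚ_[p])) [IsFiniteMeasureOnCompacts ν']
    {s : ℝ} (hs : 0 < s) (a b : ℕ) :
    IntegrableOn (fun z : ℚ_[p] × ℚ_[p] => ‖z.2 ^ 3 - z.1 ^ 4‖ ^ s)
      (padicBall p a ×ˢ padicBall p b) ν' :=
  (continuous_norm_rpow_comp p hs (by fun_prop)).continuousOn.integrableOn_compact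
    ((isCompact_padicBall p a).prod (isCompact_padicBall p b))

variable (ν) in
/-- The integral of `|y³ - x⁴|^s` over a product set. -/
noncomputable def cuspIntegral (s : ℝ) (S T : Set ℚ_[p]) : ℝ :=
  ∫ z in S ×ˢ T, ‖z.2 ^ 3 - z.1 ^ 4‖ ^ s ∂(ν.prod ν)

lemma cuspIntegral_left {s : ℝ} (hs : 0 < s) (a b : ℕ) :
    cuspIntegral p ν s (padicBall p a) (padicBall p b) =
      cuspIntegral p ν s (padicSphere p a) (padicBall p b) +
        cuspIntegral p ν s (padicBall p (a + 1)) (padicBall p b) := by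
  have hi := integrableOn_cusp p (ν.prod ν) hs
  rw [cuspIntegral, padicBall_eq_union p a, Set.union_prod]
  exact setIntegral_union (Set.disjoint_prod.2 (Or.inl (disjoint_padicSphere_padicBall p a)))
    ((measurableSet_padicBall p _).prod (measurableSet_padicBall p _))
    ((hi a b).mono_set (Set.prod_mono_left (padicSphere_subset_padicBall p a))) (hi _ _)

lemma cuspIntegral_right {s : ℝ} (hs : 0 < s) {S : Set ℚ_[p]} (hS : MeasurableSet S) {a : ℕ}
    (hSa : S ⊆ padicBall p a) (b : ℕ) :
    cuspIntegral p ν s S (padicBall p b) =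
      cuspIntegral p ν s S (padicSphere p b) + cuspIntegral p ν s S (padicBall p (b + 1)) := by
  have hi := integrableOn_cusp p (ν.prod ν) hs
  rw [cuspIntegral, padicBall_eq_union p b, Set.prod_union]
  exact setIntegral_union (Set.disjoint_prod.2 (Or.inr (disjoint_padicSphere_padicBall p b)))
    (hS.prod (measurableSet_padicBall p _))
    ((hi a b).mono_set (Set.prod_mono hSa (padicSphere_subset_padicBall p b)))
    ((hi a (b + 1)).mono_set (Set.prod_mono_left hSa))

omit [BorelSpace ℚ_[p]] in
lemma cuspIntegral_eq_of_const {s : ℝ} {S T : Set ℚ_[p]} (hS : MeasurableSet S)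
    (hT : MeasurableSet T) (n : ℕ)
    (h : ∀ x ∈ S, ∀ y ∈ T, ‖y ^ 3 - x ^ 4‖ = (p : ℝ)⁻¹ ^ n) :
    cuspIntegral p ν s S T = ν.real S * ν.real T * ((p : ℝ) ^ (-s)) ^ n := by
  rw [cuspIntegral, setIntegral_congr_fun (g := fun _ => ((p : ℝ) ^ (-s)) ^ n) (hS.prod hT)
    (fun z hz => by
      dsimp only
      rw [h _ hz.1 _ hz.2, rpow_inv_pow_natCast]), setIntegral_const, measureReal_prod_prod]
  rfl

lemma cuspIntegral_sphere_ball (hν : ν (padicBall p 0) = 1) (s : ℝ) {a b : ℕ}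
    (h : 4 * a < 3 * b) :
    cuspIntegral p ν s (padicSphere p a) (padicBall p b) =
      (1 - (p : ℝ)⁻¹) * (p : ℝ)⁻¹ ^ a * (p : ℝ)⁻¹ ^ b * ((p : ℝ) ^ (-s)) ^ (4 * a) := by
  rw [cuspIntegral_eq_of_const p (measurableSet_padicSphere p a) (measurableSet_padicBall p b)
    (4 * a), measureReal_padicSphere p hν, measureReal_padicBall p hν]
  intro x hx y hy
  have hx : ‖x ^ 4‖ = (p : ℝ)⁻¹ ^ (4 * a) := by
    rw [norm_pow, show ‖x‖ = _ from hx, ← pow_mul, mul_comm]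
  have hy : ‖y ^ 3‖ < (p : ℝ)⁻¹ ^ (4 * a) := by
    refine lt_of_le_of_lt ?_ (norm_inv_pow_lt p h)
    rw [norm_pow, mul_comm 3, pow_mul]
    exact pow_le_pow_left₀ (norm_nonneg _) hy 3
  rw [sub_eq_add_neg, Padic.add_eq_max_of_ne (by rw [norm_neg, hx]; exact hy.ne), norm_neg, hx,
    max_eq_right hy.le]

lemma cuspIntegral_ball_sphere (hν : ν (padicBall p 0) = 1) (s : ℝ) {a b : ℕ}
    (h : 3 * b < 4 * a) :
    cuspIntegral p ν s (padicBall p a) (padicSphere p b) =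
      (1 - (p : ℝ)⁻¹) * (p : ℝ)⁻¹ ^ a * (p : ℝ)⁻¹ ^ b * ((p : ℝ) ^ (-s)) ^ (3 * b) := by
  rw [cuspIntegral_eq_of_const p (measurableSet_padicBall p a) (measurableSet_padicSphere p b)
    (3 * b), measureReal_padicSphere p hν, measureReal_padicBall p hν]
  · ring
  intro x hx y hy
  have hy : ‖y ^ 3‖ = (p : ℝ)⁻¹ ^ (3 * b) := by
    rw [norm_pow, show ‖y‖ = _ from hy, ← pow_mul, mul_comm]
  have hx : ‖x ^ 4‖ < (p : ℝ)⁻¹ ^ (3 * b) := by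
    refine lt_of_le_of_lt ?_ (norm_inv_pow_lt p h)
    rw [norm_pow, mul_comm 4, pow_mul]
    exact pow_le_pow_left₀ (norm_nonneg _) hx 4
  rw [sub_eq_add_neg, Padic.add_eq_max_of_ne (by rw [norm_neg, hy]; exact hx.ne'), norm_neg, hy,
    max_eq_left hx.le]

/-- Substituting `y = x w` and translating, the integral over pairs of units reduces to the
one-variable integral. -/
lemma cuspIntegral_units (hν : ν (padicBall p 0) = 1) {s : ℝ} (hs : 0 < s) :
    cuspIntegral p ν s (padicSphere p 0) (padicSphere p 0) =
      (1 - (p : ℝ)⁻¹) * ((∫ x in padicBall p 0, ‖x‖ ^ s ∂ν) - (p : ℝ)⁻¹) := by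
  have hsub := Set.prod_mono (padicSphere_subset_padicBall p 0) (padicSphere_subset_padicBall p 0)
  have hS := measurableSet_padicSphere p 0
  rw [cuspIntegral, setIntegral_prod _ ((integrableOn_cusp p (ν.prod ν) hs 0 0).mono_set hsub)]
  have h1 : ∫ x in padicSphere p 0, ∫ y in padicSphere p 0, ‖y ^ 3 - x ^ 4‖ ^ s ∂ν ∂ν =
      ∫ x in padicSphere p 0, ∫ w in padicSphere p 0, ‖w ^ 3 - x‖ ^ s ∂ν ∂ν := by
    refine setIntegral_congr_fun hS fun x hx => ?_
    have hx : ‖x‖ = 1 := by simpa [padicSphere] using hx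
    rw [← setIntegral_padicSphere_mul_unit p hν hx]
    congr 1
    ext w
    rw [show (x * w) ^ 3 - x ^ 4 = x ^ 3 * (w ^ 3 - x) by ring, norm_mul, norm_pow, hx]
    simp
  have hint : IntegrableOn (fun z : ℚ_[p] × ℚ_[p] => ‖z.2 ^ 3 - z.1‖ ^ s)
      (padicSphere p 0 ×ˢ padicSphere p 0) (ν.prod ν) :=
    ((continuous_norm_rpow_comp p hs (by fun_prop)).continuousOn.integrableOn_compact
      ((isCompact_padicBall p 0).prod (isCompact_padicBall p 0))).mono_set hsub
  rw [IntegrableOn, ← Measure.prod_restrict] at hint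
  rw [h1, integral_integral_swap hint]
  rw [setIntegral_congr_fun (g := fun _ => (∫ x in padicBall p 0, ‖x‖ ^ s ∂ν) - (p : ℝ)⁻¹) hS
    fun w hw => by
      have hw : ‖w‖ = 1 := by simpa [padicSphere] using hw
      exact setIntegral_padicSphere_norm_sub_rpow p hν hs (c := w ^ 3) (by simp [hw])]
  rw [setIntegral_const, measureReal_padicSphere p hν]
  simp

lemma cuspIntegral_scale (hν : ν (padicBall p 0) = 1) {s : ℝ} (hs : 0 < s) :
    cuspIntegral p ν s (padicBall p 3) (padicBall p 4) =
      (p : ℝ)⁻¹ ^ 7 * ((p : ℝ) ^ (-s)) ^ 12 *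
        cuspIntegral p ν s (padicBall p 0) (padicBall p 0) := by
  have hi := integrableOn_cusp p (ν.prod ν) hs
  rw [cuspIntegral, cuspIntegral, setIntegral_prod _ (hi 3 4), setIntegral_prod _ (hi 0 0),
    setIntegral_padicBall_scale p hν 3]
  simp_rw [setIntegral_padicBall_scale p hν 4]
  have h (x y : ℚ_[p]) : ‖((p : ℚ_[p]) ^ 4 * y) ^ 3 - ((p : ℚ_[p]) ^ 3 * x) ^ 4‖ ^ s =
      ((p : ℝ) ^ (-s)) ^ 12 * ‖y ^ 3 - x ^ 4‖ ^ s := by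
    rw [show ((p : ℚ_[p]) ^ 4 * y) ^ 3 - ((p : ℚ_[p]) ^ 3 * x) ^ 4 =
      (p : ℚ_[p]) ^ 12 * (y ^ 3 - x ^ 4) by ring, norm_mul, norm_pow, Padic.norm_p,
      Real.mul_rpow (by positivity) (norm_nonneg _), rpow_inv_pow_natCast]
  simp_rw [h, integral_const_mul]
  ring

/-- Functional equation obtained by peeling off spheres from `ℤ_p × ℤ_p` down to
`p³ℤ_p × p⁴ℤ_p`. -/
lemma cuspIntegral_functional_equation (hν : ν (padicBall p 0) = 1) {s : ℝ} (hs : 0 < s)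
    {q t : ℝ} (hq : q = (p : ℝ)⁻¹) (ht : t = (p : ℝ) ^ (-s)) :
    cuspIntegral p ν s (padicBall p 0) (padicBall p 0) * (1 - q ^ 7 * t ^ 12) =
      (1 - q) * ((1 - q) / (1 - t * q) - q + 2 * q + q ^ 2 * t ^ 3 + q ^ 3 * t ^ 4 +
        q ^ 4 * t ^ 6 + q ^ 5 * t ^ 8 + q ^ 6 * t ^ 9) := by
  have hB (a b : ℕ) := cuspIntegral_right (ν := ν) p hs (measurableSet_padicBall p a)
    subset_rfl b
  have e0 := cuspIntegral_left (ν := ν) p hs 0 0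
  have e1 := cuspIntegral_right (ν := ν) p hs (measurableSet_padicSphere p 0)
    (padicSphere_subset_padicBall p 0) 0
  have e2 := cuspIntegral_left (ν := ν) p hs 1 2
  have e3 := cuspIntegral_left (ν := ν) p hs 2 3
  have u := cuspIntegral_units p hν hs
  rw [setIntegral_padicBall_norm_rpow p hν hs] at u
  have c1 := cuspIntegral_sphere_ball p hν s (a := 0) (b := 1) (by norm_num)
  have c2 := cuspIntegral_ball_sphere p hν s (a := 1) (b := 0) (by norm_num)
  have c3 := cuspIntegral_ball_sphere p hν s (a := 1) (b := 1) (by norm_num)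
  have c4 := cuspIntegral_sphere_ball p hν s (a := 1) (b := 2) (by norm_num)
  have c5 := cuspIntegral_ball_sphere p hν s (a := 2) (b := 2) (by norm_num)
  have c6 := cuspIntegral_sphere_ball p hν s (a := 2) (b := 3) (by norm_num)
  have c7 := cuspIntegral_ball_sphere p hν s (a := 3) (b := 3) (by norm_num)
  have sc := cuspIntegral_scale p hν hs
  have r0 := hB 1 0
  have r1 := hB 1 1
  have r2 := hB 2 2
  have r3 := hB 3 3
  rw [← hq, ← ht] at *
  norm_num at *
  linear_combination e0 + e1 + e2 + e3 + u + c1 + c2 + c3 + c4 + c5 + c6 + c7 + sc +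
    r0 + r1 + r2 + r3

end

/-- The Igusa local zeta function of the `E₆`-singularity `f(x,y) = y³ − x⁴`. -/
theorem stmt_14 (p : ℕ) [Fact p.Prime] (hp : 3 < p)
    [MeasurableSpace ℚ_[p]] [BorelSpace ℚ_[p]]
    (μ : Measure (ℚ_[p] × ℚ_[p])) [μ.IsAddHaarMeasure]
    (hμ : μ ({x : ℚ_[p] | ‖x‖ ≤ 1} ×ˢ {y : ℚ_[p] | ‖y‖ ≤ 1}) = 1)
    (s : ℝ) (hs : 0 < s) :
    (∫ z in ({x : ℚ_[p] | ‖x‖ ≤ 1} ×ˢ {y : ℚ_[p] | ‖y‖ ≤ 1}),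
        ‖z.2 ^ 3 - z.1 ^ 4‖ ^ s ∂μ)
      = ((p : ℝ) - 1) * (p : ℝ) ^ (3 * s) *
          ((p : ℝ) ^ (10 * s + 7) - (p : ℝ) ^ (9 * s + 5) + (p : ℝ) ^ (7 * s + 5)
            - (p : ℝ) ^ (5 * s + 3) + (p : ℝ) ^ (4 * s + 3) - (p : ℝ) ^ (3 * s + 2)
            + (p : ℝ) ^ (2 * s + 2) - 1) /
          (((p : ℝ) ^ (12 * s + 7) - 1) * ((p : ℝ) ^ (s + 1) - 1)) := by
  have hp1 : (1 : ℝ) < p := by exact_mod_cast (Fact.out : p.Prime).one_lt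
  have hp0 : (0 : ℝ) < p := by linarith
  obtain ⟨ν, hνH, hν⟩ : ∃ ν : Measure ℚ_[p], ν.IsAddHaarMeasure ∧ ν (padicBall p 0) = 1 :=
    ⟨Measure.addHaarMeasure (padicUnitBall p), inferInstance, Measure.addHaarMeasure_self⟩
  have hμν : μ = ν.prod ν := by
    let K := padicUnitBall p ×ˢ padicUnitBall p
    have h1 := Measure.addHaarMeasure_unique μ K
    have h2 := Measure.addHaarMeasure_unique (ν.prod ν) K
    have hK : (K : Set (ℚ_[p] × ℚ_[p])) = padicBall p 0 ×ˢ padicBall p 0 := rfl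
    rw [hK, padicBall_zero, hμ] at h1
    rw [hK, Measure.prod_prod, hν, one_mul] at h2
    rw [h1, h2]
  have key := cuspIntegral_functional_equation p hν hs rfl rfl
  rw [hμν, ← padicBall_zero]
  change cuspIntegral p ν s (padicBall p 0) (padicBall p 0) = _
  generalize cuspIntegral p ν s (padicBall p 0) (padicBall p 0) = Z at key ⊢
  have hr1 : 1 < (p : ℝ) ^ s := Real.one_lt_rpow hp1 hs
  have hexp (a b : ℕ) : (p : ℝ) ^ ((a : ℝ) * s + b) = ((p : ℝ) ^ s) ^ a * (p : ℝ) ^ b := by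
    rw [Real.rpow_add hp0, Real.rpow_natCast, mul_comm (a : ℝ), Real.rpow_mul hp0.le,
      Real.rpow_natCast]
  have h0 := hexp 3 0
  have h1 := hexp 10 7
  have h2 := hexp 9 5
  have h3 := hexp 7 5
  have h4 := hexp 5 3
  have h5 := hexp 4 3
  have h6 := hexp 3 2
  have h7 := hexp 2 2
  have h8 := hexp 12 7
  have h9 := hexp 1 1
  push_cast at h0 h1 h2 h3 h4 h5 h6 h7 h8 h9
  simp only [add_zero, pow_zero, mul_one, one_mul, pow_one] at h0 h9
  rw [h0, h1, h2, h3, h4, h5, h6, h7, h8, h9]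
  rw [Real.rpow_neg hp0.le] at key
  generalize (p : ℝ) ^ s = r at hr1 key ⊢
  generalize (p : ℝ) = q at hp1 hp0 key ⊢
  have hr0 : 0 < r := by linarith
  have d1 : 1 < r * q := one_lt_mul_of_lt_of_le hr1 hp1.le
  have d2 : 1 < r ^ 12 * q ^ 7 :=
    one_lt_mul_of_lt_of_le (one_lt_pow₀ hr1 (by norm_num)) (one_le_pow₀ hp1.le)
  have d1' : r * q - 1 ≠ 0 := by linarith
  have d2' : r ^ 12 * q ^ 7 - 1 ≠ 0 := by linarith
  have e1 : 1 - r⁻¹ * q⁻¹ = (r * q - 1) / (r * q) := by field_simp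
  have e2 : 1 - q⁻¹ ^ 7 * r⁻¹ ^ 12 = (r ^ 12 * q ^ 7 - 1) / (r ^ 12 * q ^ 7) := by field_simp
  rw [e1, e2] at key
  rw [eq_div_iff (mul_ne_zero d2' d1')]
  field_simp at key
  linear_combination key
end
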